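/- Let 0 < k < 1, λ > 1, and let A be an invertible 2×2 real matrix, regarded as a linear map of ℝ² with the maximum norm ‖(v₁,v₂)‖ = max{|v₁|,|v₂|}, satisfying: A(C^u_k) ⊆ C^u_k, A⁻¹(C^s_k) ⊆ C^s_k, ‖Av‖ ≥ λ‖v‖ for all v ∈ C^u_k, and ‖A⁻¹v‖ ≥ λ‖v‖ for all v ∈ C^s_k. Then, writing A = [[a₁₁, a₁₂],[a₂₁, a₂₂]], one has |a₁₂| ≤ k|a₁₁|, |a₂₁| ≤ k|a₁₁|, and |a₂₂| ≤ (1/λ² + k²)|a₁₁|. -/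

import Mathlib

noncomputable section

/-- The stable cone `C^s_k = {(v₁,v₂) : |v₁| ≤ k |v₂|}`. -/
def Cs (k : ℝ) : Set (ℝ × ℝ) := {v | |v.1| ≤ k * |v.2|}

/-- The unstable cone `C^u_k = {(v₁,v₂) : |v₂| ≤ k |v₁|}`. -/
def Cu (k : ℝ) : Set (ℝ × ℝ) := {v | |v.2| ≤ k * |v.1|}

/-- Let `0 < k < 1`, `λ > 1`, and let `A` be an invertible `2×2` real
matrix, regarded as a linear map of `ℝ²` with the maximum norm (the norm of `ℝ × ℝ`),
satisfying `A(C^u_k) ⊆ C^u_k`, `A⁻¹(C^s_k) ⊆ C^s_k`, `‖Av‖ ≥ λ‖v‖` on `C^u_k` and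
`‖A⁻¹v‖ ≥ λ‖v‖` on `C^s_k`.  Then `|a₁₂| ≤ k|a₁₁|`, `|a₂₁| ≤ k|a₁₁|` and
`|a₂₂| ≤ (1/λ² + k²)|a₁₁|`. -/
theorem hyperbolic_matrix_entries (k lam : ℝ) (hk : 0 < k) (hk1 : k < 1)
    (hlam : 1 < lam) (a11 a12 a21 a22 : ℝ) (A : ℝ × ℝ → ℝ × ℝ)
    (hA : ∀ v : ℝ × ℝ, A v = (a11 * v.1 + a12 * v.2, a21 * v.1 + a22 * v.2))
    (hdet : a11 * a22 - a12 * a21 ≠ 0)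
    (hconeU : ∀ v ∈ Cu k, A v ∈ Cu k)
    (hconeS : ∀ v : ℝ × ℝ, A v ∈ Cs k → v ∈ Cs k)
    (hexpU : ∀ v ∈ Cu k, lam * ‖v‖ ≤ ‖A v‖)
    (hexpS : ∀ v : ℝ × ℝ, A v ∈ Cs k → lam * ‖A v‖ ≤ ‖v‖) :
    |a12| ≤ k * |a11| ∧ |a21| ≤ k * |a11| ∧
      |a22| ≤ (1 / lam ^ 2 + k ^ 2) * |a11| := by
  have h21 : |a21| ≤ k * |a11| := by
    have h := hconeU (1, 0) (by simp [Cu, hk.le])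
    simpa [hA, Cu] using h
  have hAv : A (-a12, a11) = (0, a11 * a22 - a12 * a21) := by
    rw [hA]
    ext <;> simp only <;> ring
  have hmem : A (-a12, a11) ∈ Cs k := by
    rw [hAv]
    simp only [Cs, Set.mem_ofPred_eq, abs_zero]
    positivity
  have h12 : |a12| ≤ k * |a11| := by
    simpa [Cs] using hconeS _ hmem
  have hle : k * |a11| ≤ |a11| := mul_le_of_le_one_left (abs_nonneg _) hk1.le
  have h11 : lam ≤ |a11| := by
    have h := hexpU (1, 0) (by simp [Cu, hk.le])
    simpa [hA, Prod.norm_def, h21.trans hle] using h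
  have hD : lam * |a11 * a22 - a12 * a21| ≤ |a11| := by
    have h := hexpS _ hmem
    rw [hAv] at h
    simpa [Prod.norm_def, h12.trans hle] using h
  refine ⟨h12, h21, ?_⟩
  have hlam0 : 0 < lam := one_pos.trans hlam
  have ha : 0 < |a11| := hlam0.trans_le h11
  have hD' : |a11 * a22 - a12 * a21| ≤ 1 / lam ^ 2 * |a11| * |a11| :=
    calc |a11 * a22 - a12 * a21| ≤ |a11| / lam := by rwa [le_div_iff₀' hlam0]
      _ = 1 / lam ^ 2 * |a11| * lam := by field_simp
      _ ≤ 1 / lam ^ 2 * |a11| * |a11| := by gcongr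
  refine le_of_mul_le_mul_left ?_ ha
  calc |a11| * |a22| = |(a11 * a22 - a12 * a21) + a12 * a21| := by
        rw [sub_add_cancel, abs_mul]
    _ ≤ |a11 * a22 - a12 * a21| + |a12| * |a21| := by
        rw [← abs_mul a12]
        exact abs_add_le _ _
    _ ≤ 1 / lam ^ 2 * |a11| * |a11| + (k * |a11|) * (k * |a11|) := by gcongr
    _ = |a11| * ((1 / lam ^ 2 + k ^ 2) * |a11|) := by ring

end
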